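/- Let 𝒳₁,𝒲₁ and 𝒳₂,𝒲₂ be finite sets with PMFs p_{X₁W₁} on 𝒳₁×𝒲₁ and p_{X₂W₂} on 𝒳₂×𝒲₂. Fix C₁,C₂ ≥ 0 and R̃₁,R̃₂ > 0. For j = 1,2, let ε_j := 1 − p^n_{W_j}(T_δ(W_j)), let ε := min(ε₁,ε₂), and let codebooks consist of codewords w_j^n(l_j,μ_j), l_j ∈ [⌈2^{nR̃_j}⌉], μ_j ∈ [⌈2^{nC_j}⌉], all codewords mutually independent with w_j^n(l_j,μ_j) drawn from the pruned distribution p̃_{W_j^n}. For δ, η ∈ (0,1), define for x_j^n ∈ T_δ(X_j): E^{(μ_j)}_{L_j|X_j^n}(l_j|x_j^n) = (1−ε)·p^n_{X_j|W_j}(x_j^n|w_j^n(l_j,μ_j)) / ((1+η)·⌈2^{nR̃_j}⌉·p^n_{X_j}(x_j^n)) if w_j^n(l_j,μ_j) ∈ T_δ(W_j|x_j^n), and 0 otherwise. Then there exist δ₁, δ₂ > 0, depending only on δ and the respective PMFs and satisfying δ₁, δ₂ → 0 as δ → 0, such that if R̃₁ > I(X₁;W₁) + 4δ₁ and R̃₂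 > I(X₂;W₂) + 4δ₂, then the probability of the event { for every μ₁, every x₁^n ∈ T_δ(X₁), every μ₂, and every x₂^n ∈ T_δ(X₂): Σ_{l₁} E^{(μ₁)}_{L₁|X₁^n}(l₁|x₁^n) ≤ 1 and Σ_{l₂} E^{(μ₂)}_{L₂|X₂^n}(l₂|x₂^n) ≤ 1 } tends to 1 as n → ∞. -/

import Mathlib

open scoped BigOperators Classical

noncomputable section

/-- A probability mass function on a finite type, represented as a real-valued function. -/
def IsPMF {α : Type*} [Fintype α] (p : α → ℝ) : Prop :=
  (∀ a, 0 ≤ p a) ∧ ∑ a, p a = 1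

/-- Pushforward (marginal/image distribution) of `p` along `f`. -/
def push {α β : Type*} [Fintype α] (p : α → ℝ) (f : α → β) : β → ℝ :=
  fun b => ∑ a, if f a = b then p a else 0

/-- Shannon entropy (base 2) of a PMF, with the convention `0 * log 0 = 0`. -/
def Hent {α : Type*} [Fintype α] (p : α → ℝ) : ℝ :=
  ∑ a, -(p a * Real.logb 2 (p a))

/-- Mutual information `I(A;B)` of a joint PMF on `α × β`. -/
def I2 {α β : Type*} [Fintype α] [Fintype β] (p : α × β → ℝ) : ℝ :=
  Hent (push p Prod.fst) + Hent (push p Prod.snd) - Hent p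

/-- Conditional mutual information `I(A;B|C)` of a joint PMF on `α × β × γ`,
computed as `H(A,C) + H(B,C) - H(A,B,C) - H(C)`. -/
def CI {α β γ : Type*} [Fintype α] [Fintype β] [Fintype γ]
    (p : α × β × γ → ℝ) : ℝ :=
  Hent (push p (fun x => (x.1, x.2.2))) + Hent (push p Prod.snd)
    - Hent p - Hent (push p (fun x => x.2.2))

/-- Markov chain `A − B − C` for a joint PMF on `α × β × γ`:
`A` and `C` are conditionally independent given `B`, i.e.
`p(a,b,c) p(b) = p(a,b) p(b,c)` for all `a, b, c`. -/
def Markov {α β γ : Type*} [Fintype α] [Fintype β] [Fintype γ]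
    (p : α × β × γ → ℝ) : Prop :=
  ∀ a b c, p (a, b, c) * push p (fun x => x.2.1) b
    = push p (fun x => (x.1, x.2.1)) (a, b) * push p Prod.snd (b, c)

/-- Total variation distance `‖p − q‖₁ = (1/2) Σ |p a − q a|`. -/
def tvDist {α : Type*} [Fintype α] (p q : α → ℝ) : ℝ :=
  (1 / 2) * ∑ a, |p a - q a|

/-- `⌈2^{nC}⌉`. -/
def NC (n : ℕ) (C : ℝ) : ℕ := ⌈(2 : ℝ) ^ ((n : ℝ) * C)⌉₊

/-- Empirical distribution of the sequence `x : Fin n → α`, evaluated at `a`. -/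
def empir {α : Type*} [Fintype α] {n : ℕ} (x : Fin n → α) (a : α) : ℝ :=
  ((Finset.univ.filter fun i => x i = a).card : ℝ) / (n : ℝ)

/-- The `δ`-typical set of a PMF `q` on `α`, inside `α^n`: sequences whose empirical
distribution `ν` satisfies `|ν a − q a| ≤ δ q a` for every `a`. -/
def Typ {α : Type*} [Fintype α] (q : α → ℝ) (δ : ℝ) (n : ℕ) : Finset (Fin n → α) :=
  Finset.univ.filter fun x => ∀ a, |empir x a - q a| ≤ δ * q a

/-- `p^n_W(T_δ(W))`: probability of the `δ`-typical set under the product distribution. -/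
def prunedMass {W : Type*} [Fintype W] (pW : W → ℝ) (δ : ℝ) (n : ℕ) : ℝ :=
  ∑ wn ∈ Typ pW δ n, ∏ i, pW (wn i)

/-- The pruned distribution `p̃_{W^n}`: `p^n_W` conditioned on the `δ`-typical set. -/
def pruned {W : Type*} [Fintype W] (pW : W → ℝ) (δ : ℝ) (n : ℕ) (wn : Fin n → W) : ℝ :=
  if wn ∈ Typ pW δ n then (∏ i, pW (wn i)) / prunedMass pW δ n else 0

/-- The encoder weight `E^{(μ)}_{L|X^n}(l|x^n)` attached to the codeword `wn`:
`(1−ε) p^n_{X|W}(x^n|w^n) / ((1+η) L p^n_X(x^n))` if `w^n ∈ T_δ(W|x^n)`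
(i.e. `(x^n, w^n)` is jointly `δ`-typical), and `0` otherwise.  Here `epsv` plays the
role of `ε`, `L` of `⌈2^{nR̃}⌉`, and `p` is the joint PMF of `(X, W)`. -/
def Eenc {X W : Type*} [Fintype X] [Fintype W] (p : X × W → ℝ)
    (epsv η δ : ℝ) (n L : ℕ) (wn : Fin n → W) (xn : Fin n → X) : ℝ :=
  if (fun i => (xn i, wn i)) ∈ Typ p δ n then
    (1 - epsv) * (∏ i, p (xn i, wn i) / push p Prod.snd (wn i)) /
      ((1 + η) * (L : ℝ) * ∏ i, push p Prod.fst (xn i))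
  else 0

/-- The expectation of a product of functions of independent coordinates factors. -/
lemma sum_pi_prod {J α : Type*} [Fintype J] [DecidableEq J] [Fintype α] (f : J → α → ℝ) :
    ∑ B : J → α, ∏ j, f j (B j) = ∏ j, ∑ a, f j a := by
  rw [Finset.prod_univ_sum, Fintype.piFinset_univ]

lemma IsPMF.sum_pi {J α : Type*} [Fintype J] [DecidableEq J] [Fintype α] {q : α → ℝ}
    (hq : IsPMF q) : ∑ B : J → α, ∏ j, q (B j) = 1 := by
  rw [sum_pi_prod (fun _ => q)]
  simp [hq.2]

lemma IsPMF.le_one {α : Type*} [Fintype α] {q : α → ℝ} (hq : IsPMF q) (a : α) : q a ≤ 1 :=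
  hq.2 ▸ Finset.single_le_sum (fun b _ => hq.1 b) (Finset.mem_univ a)

lemma IsPMF.push {α β : Type*} [Fintype α] [Fintype β] {p : α → ℝ} (hp : IsPMF p) (f : α → β) :
    IsPMF (push p f) := by
  refine ⟨fun b => Finset.sum_nonneg fun a _ => ?_, ?_⟩
  · split_ifs
    exacts [hp.1 a, le_rfl]
  · unfold _root_.push
    rw [Finset.sum_comm]
    simpa using hp.2

/-- Exponential Markov inequality for sums of functions of i.i.d. coordinates. -/
lemma iid_chernoff {J α : Type*} [Fintype J] [DecidableEq J] [Fintype α] {q : α → ℝ}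
    (hq : ∀ a, 0 ≤ q a) (f : J → α → ℝ) (r : ℝ) :
    ∑ B : J → α, (if r ≤ ∑ j, f j (B j) then ∏ j, q (B j) else 0) ≤
      Real.exp (-r) * ∏ j, ∑ a, q a * Real.exp (f j a) := by
  rw [← sum_pi_prod (fun j a => q a * Real.exp (f j a)), Finset.mul_sum]
  refine Finset.sum_le_sum fun B _ => ?_
  have h0 : 0 ≤ ∏ j, q (B j) := Finset.prod_nonneg fun j _ => hq _
  rw [Finset.prod_mul_distrib, ← Real.exp_sum]
  have key : Real.exp (-r) * ((∏ j, q (B j)) * Real.exp (∑ j, f j (B j)))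
      = (∏ j, q (B j)) * Real.exp (∑ j, f j (B j) - r) := by
    rw [sub_eq_add_neg, Real.exp_add]; ring
  rw [key]
  split_ifs with h
  · exact le_mul_of_one_le_right h0 (Real.one_le_exp (by linarith))
  · positivity

lemma exp_le_one_add_add_sq {y : ℝ} (hy : |y| ≤ 1) : Real.exp y ≤ 1 + y + y ^ 2 := by
  have := (abs_le.1 (Real.abs_exp_sub_one_sub_id_le hy)).2
  linarith

/-- Exponential tail bound for an i.i.d. sum of bounded centred variables. -/
lemma iid_tail_le {α : Type*} [Fintype α] {q : α → ℝ} (hq : IsPMF q) {g : α → ℝ}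
    (hg : ∑ a, q a * g a = 0) (hg1 : ∀ a, |g a| ≤ 1) {τ : ℝ} (h0 : 0 ≤ τ) (h1 : τ ≤ 1) (n : ℕ) :
    ∑ x : Fin n → α, (if n * τ ≤ ∑ i, g (x i) then ∏ i, q (x i) else 0) ≤
      Real.exp (-(τ ^ 2 / 4) * n) := by
  have hmgf : ∑ a, q a * Real.exp (τ / 2 * g a) ≤ Real.exp (τ ^ 2 / 4) := by
    calc ∑ a, q a * Real.exp (τ / 2 * g a)
        ≤ ∑ a, (q a + τ / 2 * (q a * g a) + q a * (τ ^ 2 / 4)) := by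
          refine Finset.sum_le_sum fun a _ => ?_
          have hb : |τ / 2 * g a| ≤ 1 := by
            rw [abs_mul, abs_of_nonneg (by linarith)]
            nlinarith [hg1 a, abs_nonneg (g a)]
          have hsq : g a ^ 2 ≤ 1 := (sq_le_one_iff_abs_le_one _).2 (hg1 a)
          have := exp_le_one_add_add_sq hb
          have h2 : Real.exp (τ / 2 * g a) ≤ 1 + τ / 2 * g a + τ ^ 2 / 4 := by
            nlinarith [sq_nonneg τ]
          nlinarith [mul_le_mul_of_nonneg_left h2 (hq.1 a)]
      _ = 1 + τ ^ 2 / 4 := by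
          rw [Finset.sum_add_distrib, Finset.sum_add_distrib, ← Finset.mul_sum, ← Finset.sum_mul,
            hg, hq.2]
          ring
      _ ≤ Real.exp (τ ^ 2 / 4) := by linarith [Real.add_one_le_exp (τ ^ 2 / 4)]
  calc ∑ x : Fin n → α, (if n * τ ≤ ∑ i, g (x i) then ∏ i, q (x i) else 0)
      ≤ ∑ x : Fin n → α, (if τ / 2 * (n * τ) ≤ ∑ i, τ / 2 * g (x i) then ∏ i, q (x i) else 0) := by
        refine Finset.sum_le_sum fun x _ => ?_
        have : 0 ≤ ∏ i, q (x i) := Finset.prod_nonneg fun j _ => hq.1 _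
        split_ifs with h h'
        · exact le_rfl
        · refine absurd ?_ h'
          rw [← Finset.mul_sum]
          exact mul_le_mul_of_nonneg_left h (by linarith)
        · exact this
        · exact le_rfl
    _ ≤ Real.exp (-(τ / 2 * (n * τ))) * ∏ _i : Fin n, ∑ a, q a * Real.exp (τ / 2 * g a) :=
        iid_chernoff hq.1 (fun _ a => τ / 2 * g a) _
    _ ≤ Real.exp (-(τ / 2 * (n * τ))) * Real.exp (τ ^ 2 / 4) ^ n := by
        rw [Finset.prod_const, Finset.card_univ, Fintype.card_fin]
        gcongr
        exact Finset.sum_nonneg fun a _ => mul_nonneg (hq.1 a) (Real.exp_pos _).le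
    _ = Real.exp (-(τ ^ 2 / 4) * n) := by
        rw [← Real.exp_nat_mul, ← Real.exp_add]
        congr 1
        ring

lemma card_filter_eq_sum {α : Type*} {n : ℕ} (x : Fin n → α) (a : α) :
    ((Finset.univ.filter fun i => x i = a).card : ℝ) = ∑ i, if x i = a then (1 : ℝ) else 0 := by
  simp

/-- The probability that the empirical frequency of a symbol deviates from its probability. -/
lemma empir_deviation_tendsto {α : Type*} [Fintype α] {q : α → ℝ} (hq : IsPMF q) {δ : ℝ}
    (hδ : 0 < δ) (hδ1 : δ < 1) (a : α) :
    Filter.Tendsto (fun n : ℕ => ∑ x : Fin n → α,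
      (if |empir x a - q a| ≤ δ * q a then 0 else ∏ i, q (x i))) Filter.atTop (nhds 0) := by
  have hprod : ∀ (n : ℕ) (x : Fin n → α), 0 ≤ ∏ i, q (x i) :=
    fun n x => Finset.prod_nonneg fun j _ => hq.1 _
  rcases (hq.1 a).eq_or_lt with ha | ha
  · refine tendsto_const_nhds.congr fun n => (Finset.sum_eq_zero fun x _ => ?_).symm
    split_ifs with h
    · rfl
    · by_contra hne
      refine h ?_
      have hx : ∀ i, x i ≠ a := fun i hi =>
        hne (Finset.prod_eq_zero (Finset.mem_univ i) (by rw [hi, ← ha]))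
      simp [empir, hx, ← ha]
  · set τ := δ * q a with hτ
    have hτ0 : 0 < τ := mul_pos hδ ha
    have hτ1 : τ ≤ 1 := by nlinarith [hq.le_one a]
    let g : α → ℝ := fun b => (if b = a then 1 else 0) - q a
    have hg : ∑ b, q b * g b = 0 := by
      simp only [g, mul_sub, Finset.sum_sub_distrib, ← Finset.sum_mul, hq.2]
      simp
    have hg1 : ∀ b, |g b| ≤ 1 := by
      intro b
      have := hq.le_one a
      simp only [g, abs_le]
      split_ifs <;> constructor <;> linarith
    have hbound : Filter.Tendsto (fun n : ℕ => 2 * Real.exp (-(τ ^ 2 / 4) * n))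
        Filter.atTop (nhds 0) := by
      have h1 : Filter.Tendsto (fun n : ℕ => τ ^ 2 / 4 * (n : ℝ)) Filter.atTop Filter.atTop :=
        tendsto_natCast_atTop_atTop.const_mul_atTop (by positivity)
      simpa [neg_mul] using (Real.tendsto_exp_neg_atTop_nhds_zero.comp h1).const_mul 2
    refine squeeze_zero' (Filter.Eventually.of_forall fun n => Finset.sum_nonneg fun x _ => ?_)
      ?_ hbound
    · split_ifs
      exacts [le_rfl, hprod n x]
    filter_upwards [Filter.eventually_gt_atTop 0] with n hn
    have hn' : (0 : ℝ) < n := by exact_mod_cast hn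
    have t1 := iid_tail_le hq hg hg1 hτ0.le hτ1 n
    have t2 := iid_tail_le hq (g := fun b => -g b) (by simp [hg]) (by simpa using hg1)
      hτ0.le hτ1 n
    refine le_trans ?_ ((add_le_add t1 t2).trans_eq (two_mul _).symm)
    rw [← Finset.sum_add_distrib]
    refine Finset.sum_le_sum fun x _ => ?_
    have hsum : ∑ i, g (x i) = n * (empir x a - q a) := by
      simp only [g, Finset.sum_sub_distrib, empir, card_filter_eq_sum]
      simp
      field_simp
    have h0 := hprod n x
    rw [Finset.sum_neg_distrib, hsum]
    by_cases h : |empir x a - q a| ≤ τ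
    · rw [if_pos h]
      split_ifs <;> linarith
    · rw [if_neg h]
      rcases lt_abs.1 (not_le.1 h) with h | h
      · rw [if_pos (by gcongr)]
        split_ifs <;> linarith
      · rw [if_pos (show n * τ ≤ -(n * (empir x a - q a)) by
          rw [← mul_neg]; gcongr)]
        split_ifs <;> linarith

lemma prunedMass_nonneg {α : Type*} [Fintype α] {q : α → ℝ} (hq : IsPMF q) (δ : ℝ) (n : ℕ) :
    0 ≤ prunedMass q δ n :=
  Finset.sum_nonneg fun _ _ => Finset.prod_nonneg fun _ _ => hq.1 _

lemma prunedMass_le_one {α : Type*} [Fintype α] {q : α → ℝ} (hq : IsPMF q) (δ : ℝ) (n : ℕ) :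
    prunedMass q δ n ≤ 1 := by
  rw [← hq.sum_pi (J := Fin n)]
  exact Finset.sum_le_sum_of_subset_of_nonneg (Finset.subset_univ _)
    fun _ _ _ => Finset.prod_nonneg fun _ _ => hq.1 _

/-- The typical set has asymptotically full probability. -/
lemma prunedMass_tendsto {α : Type*} [Fintype α] {q : α → ℝ} (hq : IsPMF q) {δ : ℝ}
    (hδ : 0 < δ) (hδ1 : δ < 1) :
    Filter.Tendsto (prunedMass q δ) Filter.atTop (nhds 1) := by
  have h := tendsto_finsetSum Finset.univ fun a _ => empir_deviation_tendsto hq hδ hδ1 a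
  rw [Finset.sum_const_zero] at h
  have h' := h.const_sub 1
  rw [sub_zero] at h'
  refine tendsto_of_tendsto_of_tendsto_of_le_of_le h' tendsto_const_nhds (fun n => ?_)
    fun n => prunedMass_le_one hq δ n
  have hsplit : (1 : ℝ) = prunedMass q δ n +
      ∑ x : Fin n → α, if x ∈ Typ q δ n then 0 else ∏ i, q (x i) := by
    rw [← hq.sum_pi (J := Fin n), prunedMass, ← Finset.sum_filter_add_sum_filter_not Finset.univ
      (fun x => x ∈ Typ q δ n)]
    congr 1
    · exact Finset.sum_congr (by ext; simp) fun _ _ => rfl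
    · rw [Finset.sum_filter]
      exact Finset.sum_congr rfl fun x _ => by by_cases hx : x ∈ Typ q δ n <;> simp [hx]
  have hle : ∑ x : Fin n → α, (if x ∈ Typ q δ n then 0 else ∏ i, q (x i)) ≤
      ∑ a, ∑ x : Fin n → α, (if |empir x a - q a| ≤ δ * q a then 0 else ∏ i, q (x i)) := by
    rw [Finset.sum_comm]
    refine Finset.sum_le_sum fun x _ => ?_
    have h0 : 0 ≤ ∏ i, q (x i) := Finset.prod_nonneg fun j _ => hq.1 _
    have hnn : ∀ a ∈ Finset.univ,
        0 ≤ (if |empir x a - q a| ≤ δ * q a then 0 else ∏ i, q (x i)) := fun a _ => by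
      split_ifs
      exacts [le_rfl, h0]
    split_ifs with hx
    · exact Finset.sum_nonneg hnn
    · simp only [Typ, Finset.mem_filter, Finset.mem_univ, true_and, not_forall] at hx
      obtain ⟨a, ha⟩ := hx
      refine le_trans ?_ (Finset.single_le_sum hnn (Finset.mem_univ a))
      rw [if_neg ha]
  linarith

lemma isPMF_pruned {α : Type*} [Fintype α] {q : α → ℝ} (hq : IsPMF q) {δ : ℝ} {n : ℕ}
    (h : 0 < prunedMass q δ n) : IsPMF (pruned q δ n) := by
  constructor
  · intro w
    unfold pruned
    split_ifs
    · exact div_nonneg (Finset.prod_nonneg fun _ _ => hq.1 _) h.le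
    · exact le_rfl
  · unfold pruned
    rw [← Finset.sum_filter, ← Finset.sum_div, div_eq_one_iff_eq h.ne', prunedMass]
    exact Finset.sum_congr (by ext; simp) fun _ _ => rfl

lemma sum_push_mul {α β : Type*} [Fintype α] [Fintype β] (p : α → ℝ) (f : α → β) (g : β → ℝ) :
    ∑ b, push p f b * g b = ∑ a, p a * g (f a) := by
  simp only [push, Finset.sum_mul]
  rw [Finset.sum_comm]
  simp

lemma le_push {α β : Type*} [Fintype α] {p : α → ℝ} (hp : ∀ a, 0 ≤ p a) (f : α → β) (a : α) :
    p a ≤ push p f (f a) := by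
  refine le_trans ?_ (Finset.single_le_sum (f := fun a' => if f a' = f a then p a' else 0)
    (fun a' _ => ?_) (Finset.mem_univ a))
  · simp
  · split_ifs
    exacts [hp a', le_rfl]

/-- The information density ratio `p(x,w) / (p(x) p(w))`. -/
def infoRatio {X W : Type*} [Fintype X] [Fintype W] (p : X × W → ℝ) (a : X × W) : ℝ :=
  p a / (push p Prod.fst a.1 * push p Prod.snd a.2)

/-- The expected absolute value of the information density. -/
def absInfo {X W : Type*} [Fintype X] [Fintype W] (p : X × W → ℝ) : ℝ :=
  ∑ a, p a * |Real.logb 2 (infoRatio p a)|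

lemma absInfo_nonneg {X W : Type*} [Fintype X] [Fintype W] {p : X × W → ℝ} (hp : IsPMF p) :
    0 ≤ absInfo p :=
  Finset.sum_nonneg fun a _ => mul_nonneg (hp.1 a) (abs_nonneg _)

lemma infoRatio_pos {X W : Type*} [Fintype X] [Fintype W] {p : X × W → ℝ} (hp : IsPMF p)
    {a : X × W} (ha : p a ≠ 0) : 0 < infoRatio p a := by
  have h := (hp.1 a).lt_of_ne' ha
  exact div_pos h (mul_pos (h.trans_le (le_push hp.1 Prod.fst a))
    (h.trans_le (le_push hp.1 Prod.snd a)))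

lemma I2_eq_sum {X W : Type*} [Fintype X] [Fintype W] {p : X × W → ℝ} (hp : IsPMF p) :
    I2 p = ∑ a, p a * Real.logb 2 (infoRatio p a) := by
  simp only [I2, Hent, Finset.sum_neg_distrib, sum_push_mul]
  rw [sub_neg_eq_add, ← neg_add, ← Finset.sum_add_distrib, neg_add_eq_sub, ← Finset.sum_sub_distrib]
  refine Finset.sum_congr rfl fun a _ => ?_
  by_cases ha : p a = 0
  · simp [ha]
  · have h := (hp.1 a).lt_of_ne' ha
    have h1 := h.trans_le (le_push hp.1 Prod.fst a)
    have h2 := h.trans_le (le_push hp.1 Prod.snd a)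
    rw [infoRatio, Real.logb_div ha (mul_pos h1 h2).ne', Real.logb_mul h1.ne' h2.ne']
    ring

lemma ne_zero_of_mem_Typ {α : Type*} [Fintype α] {q : α → ℝ} {δ : ℝ} {n : ℕ} {x : Fin n → α}
    (hx : x ∈ Typ q δ n) (i : Fin n) : q (x i) ≠ 0 := by
  intro h0
  have h := (Finset.mem_filter.1 hx).2 (x i)
  rw [h0, mul_zero, sub_zero, abs_nonpos_iff, empir, div_eq_zero_iff] at h
  rcases h with h | h
  · have h' := Finset.card_eq_zero.1 (Nat.cast_eq_zero.1 h)
    exact Finset.notMem_empty i (h' ▸ Finset.mem_filter.2 ⟨Finset.mem_univ i, rfl⟩)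
  · have : n = 0 := by exact_mod_cast h
    exact (this ▸ i).elim0

lemma sum_eq_sum_empir {α : Type*} [Fintype α] {n : ℕ} (hn : 0 < n) (x : Fin n → α) (h : α → ℝ) :
    ∑ i, h (x i) = n * ∑ a, empir x a * h a := by
  have hn' : (n : ℝ) ≠ 0 := by exact_mod_cast hn.ne'
  rw [Finset.mul_sum, ← Finset.sum_fiberwise Finset.univ x]
  refine Finset.sum_congr rfl fun a _ => ?_
  rw [Finset.sum_congr rfl (g := fun _ => h a) fun i hi => by rw [(Finset.mem_filter.1 hi).2],
    Finset.sum_const, nsmul_eq_mul, empir]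
  field_simp

/-- Typical average lemma for products. -/
lemma prod_le_of_mem_Typ {α : Type*} [Fintype α] {q : α → ℝ} {δ : ℝ} {n : ℕ} (hn : 0 < n)
    {x : Fin n → α} (hx : x ∈ Typ q δ n) {r : α → ℝ} (hr : ∀ a, q a ≠ 0 → 0 < r a) :
    ∏ i, r (x i) ≤ (2 : ℝ) ^ (n * (∑ a, q a * Real.logb 2 (r a)
      + δ * ∑ a, q a * |Real.logb 2 (r a)|)) := by
  have hprod : ∏ i, r (x i) = (2 : ℝ) ^ (∑ i, Real.logb 2 (r (x i))) := by
    rw [Real.rpow_sum_of_pos two_pos]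
    exact Finset.prod_congr rfl fun i _ =>
      (Real.rpow_logb two_pos (by norm_num) (hr _ (ne_zero_of_mem_Typ hx i))).symm
  rw [hprod, sum_eq_sum_empir hn x fun a => Real.logb 2 (r a)]
  refine Real.rpow_le_rpow_of_exponent_le one_le_two
    (mul_le_mul_of_nonneg_left ?_ (Nat.cast_nonneg n))
  rw [Finset.mul_sum, ← Finset.sum_add_distrib]
  refine Finset.sum_le_sum fun a _ => ?_
  have h := (Finset.mem_filter.1 hx).2 a
  have h' := mul_le_mul_of_nonneg_right h (abs_nonneg (Real.logb 2 (r a)))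
  rw [← abs_mul] at h'
  have h'' := (le_abs_self _).trans h'
  linarith

lemma Eenc_nonneg {X W : Type*} [Fintype X] [Fintype W] {p : X × W → ℝ} (hp : IsPMF p)
    {e η : ℝ} (he : e ≤ 1) (hη : 0 < η) (δ : ℝ) (n L : ℕ) (w : Fin n → W) (x : Fin n → X) :
    0 ≤ Eenc p e η δ n L w x := by
  unfold Eenc
  split_ifs
  · have h1 : 0 ≤ 1 - e := by linarith
    have h2 : 0 ≤ ∏ i, p (x i, w i) / push p Prod.snd (w i) :=
      Finset.prod_nonneg fun i _ => div_nonneg (hp.1 _) ((hp.push _).1 _)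
    have h3 : 0 ≤ ∏ i, push p Prod.fst (x i) := Finset.prod_nonneg fun i _ => (hp.push _).1 _
    positivity
  · exact le_rfl

lemma Eenc_le {X W : Type*} [Fintype X] [Fintype W] {p : X × W → ℝ} (hp : IsPMF p)
    {e η : ℝ} (he0 : 0 ≤ e) (hη : 0 < η) {δ : ℝ} {n : ℕ} (hn : 0 < n) {L : ℕ}
    (w : Fin n → W) (x : Fin n → X) :
    Eenc p e η δ n L w x ≤ (2 : ℝ) ^ (n * (I2 p + δ * absInfo p)) / L := by
  unfold Eenc
  split_ifs with h
  · have hr := prod_le_of_mem_Typ hn h fun a ha => infoRatio_pos hp ha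
    rw [← I2_eq_sum hp] at hr
    have heq : (1 - e) * (∏ i, p (x i, w i) / push p Prod.snd (w i)) /
        ((1 + η) * (L : ℝ) * ∏ i, push p Prod.fst (x i)) =
        (1 - e) / (1 + η) * ((∏ i, infoRatio p (x i, w i)) / L) := by
      simp only [infoRatio, Finset.prod_div_distrib, Finset.prod_mul_distrib]
      simp only [div_eq_mul_inv, mul_inv]
      ring
    have h1 : (1 - e) / (1 + η) ≤ 1 := (div_le_one (by linarith)).2 (by linarith)
    have h2 : 0 ≤ ∏ i, infoRatio p (x i, w i) :=
      Finset.prod_nonneg fun i _ => (infoRatio_pos hp (ne_zero_of_mem_Typ h i)).le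
    rw [heq]
    refine (mul_le_of_le_one_left (by positivity) h1).trans ?_
    exact div_le_div_of_nonneg_right hr (Nat.cast_nonneg L)
  · positivity

/-- The mean of the encoder weight under the pruned codeword distribution. -/
lemma sum_pruned_mul_Eenc_le {X W : Type*} [Fintype X] [Fintype W] {p : X × W → ℝ}
    (hp : IsPMF p) {e η : ℝ} (he0 : 0 ≤ e) (hη : 0 < η) {δ : ℝ} {n : ℕ}
    (hm : 0 < prunedMass (push p Prod.snd) δ n) (L : ℕ) (x : Fin n → X) :
    ∑ w, pruned (push p Prod.snd) δ n w * Eenc p e η δ n L w x ≤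
      1 / ((1 + η) * prunedMass (push p Prod.snd) δ n) / L := by
  set m := prunedMass (push p Prod.snd) δ n
  set P := ∏ i, push p Prod.fst (x i) with hP
  have hP0 : 0 ≤ P := Finset.prod_nonneg fun i _ => (hp.push _).1 _
  have hsum : ∑ w : Fin n → W, ∏ i, p (x i, w i) = P := by
    rw [sum_pi_prod fun i b => p (x i, b)]
    refine Finset.prod_congr rfl fun i _ => ?_
    rw [push, Fintype.sum_prod_type, Finset.sum_eq_single (x i)]
    · simp
    · intro b _ hb
      simp [hb]
    · simp
  have hterm : ∀ w : Fin n → W, pruned (push p Prod.snd) δ n w * Eenc p e η δ n L w x ≤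
      (∏ i, p (x i, w i)) * (1 / (m * (1 + η) * L * P)) := by
    intro w
    have hpp : 0 ≤ ∏ i, p (x i, w i) := Finset.prod_nonneg fun i _ => hp.1 _
    have hR : 0 ≤ (∏ i, p (x i, w i)) * (1 / (m * (1 + η) * L * P)) := by positivity
    unfold pruned Eenc
    split_ifs
    · have hle : (∏ i, push p Prod.snd (w i)) * ∏ i, p (x i, w i) / push p Prod.snd (w i) ≤
          ∏ i, p (x i, w i) := by
        rw [← Finset.prod_mul_distrib]
        refine Finset.prod_le_prod (fun i _ => mul_nonneg ((hp.push _).1 _)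
          (div_nonneg (hp.1 _) ((hp.push _).1 _))) fun i _ => ?_
        by_cases h0 : push p Prod.snd (w i) = 0
        · simpa [h0] using hp.1 _
        · rw [mul_div_cancel₀ _ h0]
      have hnn : 0 ≤ (∏ i, push p Prod.snd (w i)) * ∏ i, p (x i, w i) / push p Prod.snd (w i) :=
        mul_nonneg (Finset.prod_nonneg fun i _ => (hp.push _).1 _)
          (Finset.prod_nonneg fun i _ => div_nonneg (hp.1 _) ((hp.push _).1 _))
      calc (∏ i, push p Prod.snd (w i)) / m *
            ((1 - e) * (∏ i, p (x i, w i) / push p Prod.snd (w i)) / ((1 + η) * L * P))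
          = (1 - e) * ((∏ i, push p Prod.snd (w i)) *
            ∏ i, p (x i, w i) / push p Prod.snd (w i)) * (1 / (m * (1 + η) * L * P)) := by
            simp only [div_eq_mul_inv, mul_inv]
            ring
        _ ≤ (∏ i, p (x i, w i)) * (1 / (m * (1 + η) * L * P)) := by
            refine mul_le_mul_of_nonneg_right ?_ (by positivity)
            exact (mul_le_of_le_one_left hnn (by linarith)).trans hle
    all_goals simpa using hR
  refine (Finset.sum_le_sum fun w _ => hterm w).trans ?_
  rw [← Finset.sum_mul, hsum]
  calc P * (1 / (m * (1 + η) * L * P)) = P / P * (1 / ((1 + η) * m) / L) := by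
        simp only [div_eq_mul_inv, mul_inv]
        ring
    _ ≤ _ := mul_le_of_le_one_left (by positivity) (div_self_le_one P)

/-- Chernoff bound for one bin of an i.i.d. codebook. -/
lemma codebook_tail_le {ι κ α : Type*} [Fintype ι] [Fintype κ] [DecidableEq ι] [DecidableEq κ]
    [Fintype α] [Nonempty ι] {q : α → ℝ} (hq : IsPMF q) {Z : α → ℝ} {b m s : ℝ} (hb : 0 < b)
    (hZ0 : ∀ a, 0 ≤ Z a) (hZb : ∀ a, Z a ≤ b) (hmean : ∑ a, q a * Z a ≤ m / Fintype.card ι)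
    (hs0 : 0 < s) (hs1 : s ≤ 1) (k : κ) :
    ∑ B : ι × κ → α, (if 1 ≤ ∑ l, Z (B (l, k)) then ∏ j, q (B j) else 0) ≤
      Real.exp (-((s - s * (1 + s) * m) / b)) := by
  have hcard : (0 : ℝ) < Fintype.card ι := by exact_mod_cast Fintype.card_pos
  have hmgf : ∑ a, q a * Real.exp (s / b * Z a) ≤
      Real.exp (s / b * (1 + s) * (m / Fintype.card ι)) := by
    calc ∑ a, q a * Real.exp (s / b * Z a)
        ≤ ∑ a, (q a + s / b * (1 + s) * (q a * Z a)) := by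
          refine Finset.sum_le_sum fun a _ => ?_
          have hy0 : 0 ≤ s / b * Z a := mul_nonneg (by positivity) (hZ0 a)
          have hys : s / b * Z a ≤ s := by
            rw [div_mul_eq_mul_div, div_le_iff₀ hb]
            exact mul_le_mul_of_nonneg_left (hZb a) hs0.le
          have hexp := exp_le_one_add_add_sq (abs_le.2 ⟨by linarith, hys.trans hs1⟩)
          have h2 : Real.exp (s / b * Z a) ≤ 1 + (s / b * Z a) * (1 + s) := by nlinarith
          nlinarith [mul_le_mul_of_nonneg_left h2 (hq.1 a)]
      _ = 1 + s / b * (1 + s) * ∑ a, q a * Z a := by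
          rw [Finset.sum_add_distrib, ← Finset.mul_sum, hq.2]
      _ ≤ 1 + s / b * (1 + s) * (m / Fintype.card ι) := by gcongr
      _ ≤ _ := by linarith [Real.add_one_le_exp (s / b * (1 + s) * (m / Fintype.card ι))]
  let f : ι × κ → α → ℝ := fun j a => if j.2 = k then s / b * Z a else 0
  have hf : ∀ B : ι × κ → α, ∑ j, f j (B j) = s / b * ∑ l, Z (B (l, k)) := by
    intro B
    rw [Fintype.sum_prod_type, Finset.mul_sum]
    exact Finset.sum_congr rfl fun l _ => by simp [f]
  have hprod : ∏ j, ∑ a, q a * Real.exp (f j a) =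
      (∑ a, q a * Real.exp (s / b * Z a)) ^ Fintype.card ι := by
    rw [Fintype.prod_prod_type, ← Finset.card_univ, ← Finset.prod_const]
    refine Finset.prod_congr rfl fun l _ => ?_
    rw [Finset.prod_eq_single k]
    · simp [f]
    · intro j _ hj
      simp [f, hj, hq.2]
    · simp
  calc ∑ B : ι × κ → α, (if 1 ≤ ∑ l, Z (B (l, k)) then ∏ j, q (B j) else 0)
      = ∑ B : ι × κ → α, (if s / b ≤ ∑ j, f j (B j) then ∏ j, q (B j) else 0) := by
        refine Finset.sum_congr rfl fun B _ => ?_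
        rw [hf B]
        simp only [le_mul_iff_one_le_right (div_pos hs0 hb)]
    _ ≤ Real.exp (-(s / b)) * ∏ j, ∑ a, q a * Real.exp (f j a) := iid_chernoff hq.1 f _
    _ ≤ Real.exp (-(s / b)) *
          Real.exp (s / b * (1 + s) * (m / Fintype.card ι)) ^ Fintype.card ι := by
        rw [hprod]
        gcongr
        exact Finset.sum_nonneg fun a _ => mul_nonneg (hq.1 a) (Real.exp_pos _).le
    _ = _ := by
        rw [← Real.exp_nat_mul, ← Real.exp_add]
        congr 1
        field_simp
        ring

/-- Union bound over the bins and the source sequences. -/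
lemma codebook_union_bound {ι κ α β : Type*} [Fintype ι] [Fintype κ] [DecidableEq ι]
    [DecidableEq κ] [Fintype α] {q : α → ℝ} (hq : IsPMF q) (T : Finset β)
    (Z : α → β → ℝ) {t : ℝ}
    (htail : ∀ k, ∀ x ∈ T,
      ∑ B : ι × κ → α, (if 1 ≤ ∑ l, Z (B (l, k)) x then ∏ j, q (B j) else 0) ≤ t) :
    1 - Fintype.card κ * T.card * t ≤
      ∑ B ∈ Finset.univ.filter (fun B : ι × κ → α => ∀ k, ∀ x ∈ T, ∑ l, Z (B (l, k)) x ≤ 1),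
        ∏ j, q (B j) := by
  have h0 : ∀ B : ι × κ → α, 0 ≤ ∏ j, q (B j) :=
    fun B => Finset.prod_nonneg fun j _ => hq.1 _
  have hsplit := Finset.sum_filter_add_sum_filter_not Finset.univ
    (fun B : ι × κ → α => ∀ k, ∀ x ∈ T, ∑ l, Z (B (l, k)) x ≤ 1) fun B => ∏ j, q (B j)
  rw [hq.sum_pi] at hsplit
  have hbad : ∑ B ∈ Finset.univ.filter
      (fun B : ι × κ → α => ¬ ∀ k, ∀ x ∈ T, ∑ l, Z (B (l, k)) x ≤ 1), ∏ j, q (B j) ≤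
      Fintype.card κ * T.card * t := by
    calc _ ≤ ∑ B : ι × κ → α, ∑ k, ∑ x ∈ T,
          (if 1 ≤ ∑ l, Z (B (l, k)) x then ∏ j, q (B j) else 0) := by
          rw [Finset.sum_filter]
          refine Finset.sum_le_sum fun B _ => ?_
          have hnn : ∀ k x, 0 ≤ (if 1 ≤ ∑ l, Z (B (l, k)) x then ∏ j, q (B j) else 0) :=
            fun k x => by
              split_ifs
              exacts [h0 B, le_rfl]
          split_ifs with hB
          · exact Finset.sum_nonneg fun k _ => Finset.sum_nonneg fun x _ => hnn k x
          · push Not at hB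
            obtain ⟨k, x, hx, hlt⟩ := hB
            calc ∏ j, q (B j)
                = (if 1 ≤ ∑ l, Z (B (l, k)) x then ∏ j, q (B j) else 0) := by rw [if_pos hlt.le]
              _ ≤ ∑ x ∈ T, (if 1 ≤ ∑ l, Z (B (l, k)) x then ∏ j, q (B j) else 0) :=
                  Finset.single_le_sum
                    (f := fun x => if 1 ≤ ∑ l, Z (B (l, k)) x then ∏ j, q (B j) else 0)
                    (fun x _ => hnn k x) hx
              _ ≤ _ := Finset.single_le_sum
                    (f := fun k => ∑ x ∈ T,
                      (if 1 ≤ ∑ l, Z (B (l, k)) x then ∏ j, q (B j) else 0))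
                    (fun k _ => Finset.sum_nonneg fun x _ => hnn k x) (Finset.mem_univ k)
      _ = ∑ k : κ, ∑ x ∈ T, ∑ B : ι × κ → α,
          (if 1 ≤ ∑ l, Z (B (l, k)) x then ∏ j, q (B j) else 0) := by
          rw [Finset.sum_comm]
          exact Finset.sum_congr rfl fun k _ => Finset.sum_comm
      _ ≤ ∑ k : κ, ∑ x ∈ T, t :=
          Finset.sum_le_sum fun k _ => Finset.sum_le_sum fun x hx => htail k x hx
      _ = _ := by simp [mul_assoc]
  linarith

lemma tendsto_mul_const_nhdsWithin_zero (K : ℝ) :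
    Filter.Tendsto (fun δ : ℝ => δ * K) (nhdsWithin 0 (Set.Ioi 0)) (nhds 0) := by
  have h : Filter.Tendsto (fun δ : ℝ => δ * K) (nhds 0) (nhds (0 * K)) :=
    Filter.tendsto_id.mul_const K
  rw [zero_mul] at h
  exact h.mono_left nhdsWithin_le_nhds

/-- A doubly exponentially small probability beats an exponential number of events. -/
lemma tendsto_exp_mul_exp_neg_rpow {A c γ : ℝ} (hc : 0 < c) (hγ : 0 < γ) :
    Filter.Tendsto (fun n : ℕ => Real.exp (A * n) * Real.exp (-(c * (2 : ℝ) ^ (n * γ))))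
      Filter.atTop (nhds 0) := by
  set g := Real.log 2 * γ with hg
  have hg0 : 0 < g := mul_pos (Real.log_pos one_lt_two) hγ
  have hexp : Filter.Tendsto (fun n : ℕ => Real.exp (-(n : ℝ))) Filter.atTop (nhds 0) :=
    Real.tendsto_exp_neg_atTop_nhds_zero.comp tendsto_natCast_atTop_atTop
  refine squeeze_zero' (Filter.Eventually.of_forall fun n => by positivity) ?_ hexp
  filter_upwards [tendsto_natCast_atTop_atTop.eventually_ge_atTop (2 * (A + 1) / (c * g ^ 2))]
    with n hn
  rw [← Real.exp_add, Real.exp_le_exp, Real.rpow_def_of_pos two_pos,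
    show Real.log 2 * (n * γ) = n * g by rw [hg]; ring]
  have hn0 : (0 : ℝ) ≤ n := Nat.cast_nonneg n
  rw [div_le_iff₀ (by positivity)] at hn
  have hq := Real.quadratic_le_exp_of_nonneg (mul_nonneg hn0 hg0.le)
  have hq' : c * ((n * g) ^ 2 / 2) ≤ c * Real.exp (n * g) :=
    mul_le_mul_of_nonneg_left (by nlinarith [mul_nonneg hn0 hg0.le]) hc.le
  nlinarith [mul_le_mul_of_nonneg_left hn hn0]

lemma NC_le {n : ℕ} {C : ℝ} (hC : 0 ≤ C) : (NC n C : ℝ) ≤ 2 * (2 : ℝ) ^ (n * C) := by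
  have h1 : (1 : ℝ) ≤ (2 : ℝ) ^ (n * C) := Real.one_le_rpow one_le_two (by positivity)
  have := Nat.ceil_lt_add_one (zero_le_one.trans h1)
  unfold NC
  linarith

lemma le_NC (n : ℕ) (C : ℝ) : (2 : ℝ) ^ (n * C) ≤ NC n C := Nat.le_ceil _

/-- A single encoder is sub-normalized with probability tending to one. -/
lemma encoder_tendsto {X W : Type*} [Fintype X] [Fintype W] {p : X × W → ℝ} (hp : IsPMF p)
    {δ η C R : ℝ} (hδ : 0 < δ) (hδ1 : δ < 1) (hη : 0 < η) (hη1 : η < 1) (hC : 0 ≤ C)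
    (hR : I2 p + δ * absInfo p < R) {e : ℕ → ℝ} (he : ∀ n, 0 ≤ e n ∧ e n ≤ 1) :
    Filter.Tendsto
      (fun n : ℕ => ∑ B ∈ Finset.univ.filter
        (fun B : Fin (NC n R) × Fin (NC n C) → (Fin n → W) =>
          ∀ μ : Fin (NC n C), ∀ x ∈ Typ (push p Prod.fst) δ n,
            (∑ l : Fin (NC n R), Eenc p (e n) η δ n (NC n R) (B (l, μ)) x) ≤ 1),
        ∏ j, pruned (push p Prod.snd) δ n (B j)) Filter.atTop (nhds 1) := by
  set γ := R - (I2 p + δ * absInfo p) with hγ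
  have hγ0 : 0 < γ := sub_pos.2 hR
  set m := 1 / (1 + η / 2) with hm
  set s := η / 4 with hs
  set c := s - s * (1 + s) * m with hc
  have hc0 : 0 < c := by
    have h1 : (1 + s) * m < 1 := by
      rw [hm, mul_one_div, div_lt_one (by linarith)]
      linarith
    have hs0 : 0 < s := by positivity
    nlinarith
  have hX : (0 : ℝ) < Fintype.card X := by
    have : Nonempty X := by
      by_contra h
      rw [not_nonempty_iff] at h
      simpa using hp.2
    exact_mod_cast Fintype.card_pos
  set A := Real.log 2 * C + Real.log (Fintype.card X) with hA
  have hlow : Filter.Tendsto (fun n : ℕ => 1 - 2 * (Real.exp (A * n) *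
      Real.exp (-(c * (2 : ℝ) ^ (n * γ))))) Filter.atTop (nhds 1) := by
    simpa using ((tendsto_exp_mul_exp_neg_rpow (A := A) hc0 hγ0).const_mul 2).const_sub 1
  have hmass := prunedMass_tendsto (hp.push Prod.snd) hδ hδ1
  have hev : ∀ᶠ n : ℕ in Filter.atTop,
      (1 + η / 2) / (1 + η) < prunedMass (push p Prod.snd) δ n :=
    hmass.eventually_const_lt ((div_lt_one (by linarith)).2 (by linarith))
  refine tendsto_of_tendsto_of_tendsto_of_le_of_le' hlow tendsto_const_nhds ?_ ?_
  · filter_upwards [hev, Filter.eventually_gt_atTop 0] with n hn hn0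
    have hM : 0 < prunedMass (push p Prod.snd) δ n := lt_trans (by positivity) hn
    have hq := isPMF_pruned (hp.push Prod.snd) hM
    have hL0 : (0 : ℝ) < NC n R := lt_of_lt_of_le (by positivity) (le_NC n R)
    have : Nonempty (Fin (NC n R)) := ⟨⟨0, by exact_mod_cast hL0⟩⟩
    have hb : (0 : ℝ) < (2 : ℝ) ^ (-(n * γ)) := by positivity
    have hub : ∀ (w : Fin n → W) (x : Fin n → X),
        Eenc p (e n) η δ n (NC n R) w x ≤ (2 : ℝ) ^ (-(n * γ)) := by
      intro w x
      refine (Eenc_le hp (he n).1 hη hn0 w x).trans ?_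
      rw [div_le_iff₀ hL0]
      calc (2 : ℝ) ^ (n * (I2 p + δ * absInfo p))
          = (2 : ℝ) ^ (-(n * γ)) * (2 : ℝ) ^ (n * R) := by
            rw [← Real.rpow_add two_pos, hγ]
            congr 1
            ring
        _ ≤ _ := by
            gcongr
            exact le_NC n R
    have hmean : ∀ x : Fin n → X, ∑ w, pruned (push p Prod.snd) δ n w *
        Eenc p (e n) η δ n (NC n R) w x ≤ m / Fintype.card (Fin (NC n R)) := by
      intro x
      refine (sum_pruned_mul_Eenc_le hp (he n).1 hη hM (NC n R) x).trans ?_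
      rw [Fintype.card_fin, hm]
      rw [div_lt_iff₀ (by linarith)] at hn
      gcongr
      linarith
    have hunion := codebook_union_bound (ι := Fin (NC n R)) (κ := Fin (NC n C)) hq
      (Typ (push p Prod.fst) δ n) (Eenc p (e n) η δ n (NC n R)) fun k x _ =>
        codebook_tail_le hq hb (fun w => Eenc_nonneg hp (he n).2 hη δ n _ w x)
          (fun w => hub w x) (hmean x) (show 0 < s by positivity) (by linarith) k
    refine le_trans ?_ (hunion.trans_eq ?_)
    · have hT : ((Typ (push p Prod.fst) δ n).card : ℝ) ≤ (Fintype.card X : ℝ) ^ n := by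
        have := Finset.card_le_univ (Typ (push p Prod.fst) δ n)
        rw [Fintype.card_fun, Fintype.card_fin] at this
        exact_mod_cast this
      have hexp : Real.exp (A * n) = (2 : ℝ) ^ (n * C) * (Fintype.card X : ℝ) ^ n := by
        rw [Real.rpow_def_of_pos two_pos, ← Real.rpow_natCast, Real.rpow_def_of_pos hX,
          ← Real.exp_add, hA]
        congr 1
        ring
      have hdiv : c / (2 : ℝ) ^ (-(n * γ)) = c * (2 : ℝ) ^ (n * γ) := by
        rw [Real.rpow_neg two_pos.le, div_inv_eq_mul]
      rw [← hc, hdiv, hexp, Fintype.card_fin, ← mul_assoc, ← mul_assoc]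
      have := NC_le (n := n) hC
      gcongr
    · congr!
  · filter_upwards [hev] with n hn
    have hM : 0 < prunedMass (push p Prod.snd) δ n := lt_trans (by positivity) hn
    have hq := isPMF_pruned (hp.push Prod.snd) hM
    rw [← hq.sum_pi (J := Fin (NC n R) × Fin (NC n C))]
    exact Finset.sum_le_sum_of_subset_of_nonneg (Finset.subset_univ _)
      fun _ _ _ => Finset.prod_nonneg fun _ _ => hq.1 _

/-- **Lemma 1 (both distributed encoders are sub-normalized with high probability).**
For joint PMFs `p₁` on `𝒳₁ × 𝒲₁` and `p₂` on `𝒳₂ × 𝒲₂`, `C₁, C₂ ≥ 0`, draw two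
mutually independent codebooks `w_j^n(l_j,μ_j)`, `l_j ∈ [⌈2^{nR̃_j}⌉]`,
`μ_j ∈ [⌈2^{nC_j}⌉]`, with codewords i.i.d. from the respective pruned distributions.
With `ε := min(ε₁, ε₂)` where `ε_j := 1 − p^n_{W_j}(T_δ(W_j))`, there are
`δ₁, δ₂ > 0` depending only on `δ` (and the respective PMFs), tending to `0` as
`δ → 0`, such that whenever `R̃₁ > I(X₁;W₁) + 4δ₁` and `R̃₂ > I(X₂;W₂) + 4δ₂`,
the probability that `Σ_{l₁} E^{(μ₁)}_{L₁|X₁^n}(l₁|x₁^n) ≤ 1` and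
`Σ_{l₂} E^{(μ₂)}_{L₂|X₂^n}(l₂|x₂^n) ≤ 1` hold for all `μ₁, μ₂` and all `δ`-typical
`x₁^n, x₂^n` tends to `1` as `n → ∞`. -/
theorem statement6 {X1 W1 X2 W2 : Type} [Fintype X1] [Fintype W1] [Fintype X2] [Fintype W2]
    (p1 : X1 × W1 → ℝ) (hp1 : IsPMF p1) (p2 : X2 × W2 → ℝ) (hp2 : IsPMF p2) :
    ∃ d1 d2 : ℝ → ℝ,
      (∀ δ : ℝ, 0 < δ → δ < 1 → 0 < d1 δ ∧ 0 < d2 δ) ∧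
      Filter.Tendsto d1 (nhdsWithin 0 (Set.Ioi 0)) (nhds 0) ∧
      Filter.Tendsto d2 (nhdsWithin 0 (Set.Ioi 0)) (nhds 0) ∧
      ∀ δ η C1 C2 Rt1 Rt2 : ℝ, 0 < δ → δ < 1 → 0 < η → η < 1 →
        0 ≤ C1 → 0 ≤ C2 → 0 < Rt1 → 0 < Rt2 →
        I2 p1 + 4 * d1 δ < Rt1 → I2 p2 + 4 * d2 δ < Rt2 →
        Filter.Tendsto
          (fun n : ℕ =>
            ∑ B ∈ Finset.univ.filter
              (fun B : (Fin (NC n Rt1) × Fin (NC n C1) → (Fin n → W1)) ×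
                       (Fin (NC n Rt2) × Fin (NC n C2) → (Fin n → W2)) =>
                (∀ μ1 : Fin (NC n C1), ∀ xn ∈ Typ (push p1 Prod.fst) δ n,
                  (∑ l1 : Fin (NC n Rt1),
                    Eenc p1
                      (min (1 - prunedMass (push p1 Prod.snd) δ n)
                           (1 - prunedMass (push p2 Prod.snd) δ n))
                      η δ n (NC n Rt1) (B.1 (l1, μ1)) xn) ≤ 1) ∧
                (∀ μ2 : Fin (NC n C2), ∀ xn ∈ Typ (push p2 Prod.fst) δ n,
                  (∑ l2 : Fin (NC n Rt2),
                    Eenc p2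
                      (min (1 - prunedMass (push p1 Prod.snd) δ n)
                           (1 - prunedMass (push p2 Prod.snd) δ n))
                      η δ n (NC n Rt2) (B.2 (l2, μ2)) xn) ≤ 1)),
              (∏ j : Fin (NC n Rt1) × Fin (NC n C1), pruned (push p1 Prod.snd) δ n (B.1 j)) *
              (∏ j : Fin (NC n Rt2) × Fin (NC n C2), pruned (push p2 Prod.snd) δ n (B.2 j)))
          Filter.atTop (nhds 1) := by
  refine ⟨fun δ => δ * (absInfo p1 + 1), fun δ => δ * (absInfo p2 + 1), ?_,
    tendsto_mul_const_nhdsWithin_zero _, tendsto_mul_const_nhdsWithin_zero _, ?_⟩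
  · intro δ hδ _
    have h1 := absInfo_nonneg hp1
    have h2 := absInfo_nonneg hp2
    constructor <;> positivity
  intro δ η C1 C2 Rt1 Rt2 hδ hδ1 hη hη1 hC1 hC2 _ _ hR1 hR2
  have hrate : ∀ {K I R : ℝ}, 0 ≤ K → I + 4 * (δ * (K + 1)) < R → I + δ * K < R := by
    intro K I R hK h
    nlinarith [mul_nonneg hδ.le hK]
  have he : ∀ n, 0 ≤ min (1 - prunedMass (push p1 Prod.snd) δ n)
      (1 - prunedMass (push p2 Prod.snd) δ n) ∧ min (1 - prunedMass (push p1 Prod.snd) δ n)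
      (1 - prunedMass (push p2 Prod.snd) δ n) ≤ 1 := fun n =>
    ⟨le_min (sub_nonneg.2 (prunedMass_le_one (hp1.push _) δ n))
      (sub_nonneg.2 (prunedMass_le_one (hp2.push _) δ n)),
      (min_le_left _ _).trans (sub_le_self _ (prunedMass_nonneg (hp1.push _) δ n))⟩
  have h1 := encoder_tendsto hp1 hδ hδ1 hη hη1 hC1 (hrate (absInfo_nonneg hp1) hR1) he
  have h2 := encoder_tendsto hp2 hδ hδ1 hη hη1 hC2 (hrate (absInfo_nonneg hp2) hR2) he
  have h := h1.mul h2
  rw [mul_one] at h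
  refine h.congr fun n => ?_
  rw [Finset.sum_mul_sum, ← Finset.sum_product', ← Finset.filter_product, Finset.univ_product_univ]
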